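/- For every odd integer n with 5 ≤ n ≤ 2700, setting k := (n−1)/2, the inequality M(k−1, k) < Λ_plane(n) holds, where M(k,l) and Λ_plane(n) are the explicit quantities defined in the context. -/

import Mathlib

open MeasureTheory Real


/-- The renormalized lens energy `Λ_plane(n)`. -/
noncomputable def lambdaPlane (n : ℕ) : ℝ :=
  let ω : ℝ := Real.pi ^ (((n:ℝ) - 1)/2) / Real.Gamma (((n:ℝ) + 1)/2)
  (2 * ((n:ℝ) - 1) * ω * (∫ t in (1/2:ℝ)..1, (1 - t ^ 2) ^ (((n:ℝ) - 3)/2))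
      - ω * (Real.sqrt 3 / 2) ^ ((n:ℝ) - 1))
    / (2 * ω * (∫ t in (1/2:ℝ)..1, (1 - t ^ 2) ^ (((n:ℝ) - 1)/2))) ^ (((n:ℝ) - 1)/(n:ℝ))

/-- The energy `M(k,l)` of the explicit `SO(k+1) × SO(l+1)`-invariant competitor adapted
to the Lawson cone `C_{k,l}` in dimension `n = k + l + 2`. -/
noncomputable def lawsonCompetitorEnergy (k l : ℕ) : ℝ :=
  let n : ℝ := (k:ℝ) + (l:ℝ) + 2
  let lam : ℝ := Real.sqrt ((k:ℝ) / (l:ℝ))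
  let θ : ℝ := Real.arctan lam
  let h : ℝ := lam * Real.tan (2 * Real.pi / 3 - θ) - 1
  let r : ℝ := lam / Real.cos (2 * Real.pi / 3 - θ)
  let d : ℝ := Real.tan (Real.pi / 6 + θ) - lam
  let ρ : ℝ := 1 / Real.cos (Real.pi / 6 + θ)
  let ωk : ℝ := Real.pi ^ (((k:ℝ) + 1)/2) / Real.Gamma (((k:ℝ) + 1)/2 + 1)
  let ωl : ℝ := Real.pi ^ (((l:ℝ) + 1)/2) / Real.Gamma (((l:ℝ) + 1)/2 + 1)
  let V : ℝ := ωk * ωl *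
    (lam ^ (k + 1)
      + ((k:ℝ) + 1) * (∫ u in lam..(ρ - d), u ^ k * (ρ ^ 2 - (u + d) ^ 2) ^ (((l:ℝ) + 1)/2))
      + ((l:ℝ) + 1) * (∫ v in (1:ℝ)..(r - h), v ^ l * (r ^ 2 - (v + h) ^ 2) ^ (((k:ℝ) + 1)/2)))
  let P : ℝ := ωk * ωl * ((k:ℝ) + 1) * ((l:ℝ) + 1) *
    (ρ * (∫ u in lam..(ρ - d), u ^ k * (ρ ^ 2 - (u + d) ^ 2) ^ (((l:ℝ) - 1)/2))
      + r * (∫ v in (1:ℝ)..(r - h), v ^ l * (r ^ 2 - (v + h) ^ 2) ^ (((k:ℝ) - 1)/2)))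
  (P - ωk * ωl * ((k:ℝ) + 1) * ((l:ℝ) + 1) * lam ^ k * Real.sqrt (1 + lam ^ 2)
      / ((k:ℝ) + (l:ℝ) + 1))
    / V ^ ((n - 1)/n)



lemma cap_cont (p : ℕ) (s R e : ℝ) (hs : 0 ≤ s) :
    Continuous (fun x : ℝ => x ^ p * (R ^ 2 - (x + e) ^ 2) ^ s) := by
  apply Continuous.mul (by fun_prop)
  exact Continuous.rpow_const (by fun_prop) (fun _ => Or.inr hs)

lemma cap_deriv (p : ℕ) (s R e x : ℝ) (hs : 0 ≤ s) :
    HasDerivAt (fun x : ℝ => x ^ p * (R ^ 2 - (x + e) ^ 2) ^ (s + 1))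
      ((p : ℝ) * x ^ (p - 1) * (R ^ 2 - (x + e) ^ 2) ^ (s + 1)
        + x ^ p * ((-(2 * (x + e))) * (s + 1) * (R ^ 2 - (x + e) ^ 2) ^ s)) x := by
  have h1 : HasDerivAt (fun x : ℝ => R ^ 2 - (x + e) ^ 2) (-(2 * (x + e))) x := by
    have := (((hasDerivAt_id x).add_const e).pow 2).const_sub (R ^ 2)
    simpa using this
  have h2 := h1.rpow_const (p := s + 1) (Or.inr (by linarith))
  rw [add_sub_cancel_right] at h2
  exact (hasDerivAt_pow p x).mul h2

lemma cap_rpow_succ (s y : ℝ) (hs : 0 ≤ s) (hy : 0 ≤ y) : y ^ (s + 1) = y ^ s * y := by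
  rw [Real.rpow_add_one' hy (by linarith)]

/-- integration by parts -/
lemma cap_parts (p : ℕ) (s R e x0 : ℝ) (hs : 0 ≤ s) (hx : x0 ≤ R - e) (h0 : 0 < x0) (he : 0 ≤ e) :
    ((p : ℝ) + 1) * (∫ x in x0..(R - e), x ^ p * (R ^ 2 - (x + e) ^ 2) ^ (s + 1)) *
        (((p : ℝ) + 1) + 2 * (s + 1))
      = ((p : ℝ) + 1) * (2 * (s + 1)) *
          (∫ x in x0..(R - e), (R ^ 2 - e * (x + e)) * (x ^ p * (R ^ 2 - (x + e) ^ 2) ^ s))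
        - ((p : ℝ) + 1) * (x0 ^ (p + 1) * (R ^ 2 - (x0 + e) ^ 2) ^ (s + 1)) := by
  have hc := cap_cont p s R e hs
  have hc1 := cap_cont p (s + 1) R e (by linarith)
  have hc2 : Continuous (fun x : ℝ => (R ^ 2 - e * (x + e)) * (x ^ p * (R ^ 2 - (x + e) ^ 2) ^ s)) :=
    Continuous.mul (by fun_prop) hc
  have hd : Continuous (fun x : ℝ => (((p + 1 : ℕ) : ℝ) * x ^ (p + 1 - 1) * (R ^ 2 - (x + e) ^ 2) ^ (s + 1)
        + x ^ (p + 1) * ((-(2 * (x + e))) * (s + 1) * (R ^ 2 - (x + e) ^ 2) ^ s))) := by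
    have e1 : Continuous (fun x : ℝ => (R ^ 2 - (x + e) ^ 2) ^ (s + 1)) :=
      Continuous.rpow_const (by fun_prop) (fun _ => Or.inr (by linarith))
    have e2 : Continuous (fun x : ℝ => (R ^ 2 - (x + e) ^ 2) ^ s) :=
      Continuous.rpow_const (by fun_prop) (fun _ => Or.inr hs)
    fun_prop
  have key := intervalIntegral.integral_eq_sub_of_hasDerivAt (a := x0) (b := R - e)
    (fun x _ => cap_deriv (p + 1) s R e x hs) (hd.intervalIntegrable _ _)
  have hz : R ^ 2 - (R - e + e) ^ 2 = 0 := by ring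
  rw [hz, Real.zero_rpow (by linarith), mul_zero, zero_sub] at key
  have hcong : (∫ x in x0..(R - e), (((p + 1 : ℕ) : ℝ) * x ^ (p + 1 - 1) * (R ^ 2 - (x + e) ^ 2) ^ (s + 1)
        + x ^ (p + 1) * ((-(2 * (x + e))) * (s + 1) * (R ^ 2 - (x + e) ^ 2) ^ s)))
      = ∫ x in x0..(R - e), ((((p : ℝ) + 1) + 2 * (s + 1)) * (x ^ p * (R ^ 2 - (x + e) ^ 2) ^ (s + 1))
        - (2 * (s + 1)) * ((R ^ 2 - e * (x + e)) * (x ^ p * (R ^ 2 - (x + e) ^ 2) ^ s))) := by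
    apply intervalIntegral.integral_congr
    intro x hxm
    rw [Set.uIcc_of_le hx] at hxm
    have hw : 0 ≤ R ^ 2 - (x + e) ^ 2 := by nlinarith [hxm.1, hxm.2]
    simp only [Nat.add_sub_cancel, cap_rpow_succ s _ hs hw]
    push_cast
    ring
  rw [hcong, intervalIntegral.integral_sub ((hc1.const_mul _).intervalIntegrable _ _)
    ((hc2.const_mul _).intervalIntegrable _ _), intervalIntegral.integral_const_mul,
    intervalIntegral.integral_const_mul] at key
  linear_combination ((p : ℝ) + 1) * key

/-- supersolution bound -/
lemma cap_bound (p : ℕ) (s R e x0 G A0 A1 : ℝ) (hp : 1 ≤ p) (hs : 0 ≤ s) (hx : x0 ≤ R - e)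
    (h0 : 0 < x0) (he : 0 ≤ e) (hG : 0 ≤ G)
    (hA0 : A0 ≤ G * (2 * (s + 1) * (x0 + e) - p * (R ^ 2 - (x0 + e) ^ 2) / x0))
    (hA1 : A1 ≤ G * (2 * (s + 1) + p + p * (R + e) / x0)) :
    (∫ x in x0..(R - e), (A0 + A1 * (x - x0)) * (x ^ p * (R ^ 2 - (x + e) ^ 2) ^ s))
      ≤ G * (x0 ^ p * (R ^ 2 - (x0 + e) ^ 2) ^ (s + 1)) := by
  have hc := cap_cont p s R e hs
  have hc2 : Continuous (fun x : ℝ => (A0 + A1 * (x - x0)) * (x ^ p * (R ^ 2 - (x + e) ^ 2) ^ s)) :=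
    Continuous.mul (by fun_prop) hc
  have hd : Continuous (fun x : ℝ => ((p : ℝ) * x ^ (p - 1) * (R ^ 2 - (x + e) ^ 2) ^ (s + 1)
        + x ^ p * ((-(2 * (x + e))) * (s + 1) * (R ^ 2 - (x + e) ^ 2) ^ s))) := by
    have e1 : Continuous (fun x : ℝ => (R ^ 2 - (x + e) ^ 2) ^ (s + 1)) :=
      Continuous.rpow_const (by fun_prop) (fun _ => Or.inr (by linarith))
    have e2 : Continuous (fun x : ℝ => (R ^ 2 - (x + e) ^ 2) ^ s) :=
      Continuous.rpow_const (by fun_prop) (fun _ => Or.inr hs)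
    fun_prop
  have key := intervalIntegral.integral_eq_sub_of_hasDerivAt (a := x0) (b := R - e)
    (fun x _ => cap_deriv p s R e x hs) (hd.intervalIntegrable _ _)
  have hz : R ^ 2 - (R - e + e) ^ 2 = 0 := by ring
  rw [hz, Real.zero_rpow (by linarith), mul_zero, zero_sub] at key
  have hmono : (∫ x in x0..(R - e), (A0 + A1 * (x - x0)) * (x ^ p * (R ^ 2 - (x + e) ^ 2) ^ s))
      ≤ ∫ x in x0..(R - e), (-G) * ((p : ℝ) * x ^ (p - 1) * (R ^ 2 - (x + e) ^ 2) ^ (s + 1)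
        + x ^ p * ((-(2 * (x + e))) * (s + 1) * (R ^ 2 - (x + e) ^ 2) ^ s)) := by
    apply intervalIntegral.integral_mono_on hx (hc2.intervalIntegrable _ _)
      ((hd.const_mul _).intervalIntegrable _ _)
    intro x hxm
    have hxp : 0 < x := lt_of_lt_of_le h0 hxm.1
    have hw : 0 ≤ R ^ 2 - (x + e) ^ 2 := by nlinarith [hxm.1, hxm.2]
    obtain ⟨q, rfl⟩ : ∃ q, p = q + 1 := ⟨p - 1, by omega⟩
    rw [cap_rpow_succ s _ hs hw]
    simp only [Nat.add_sub_cancel]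
    have hpos : 0 ≤ x ^ q * (R ^ 2 - (x + e) ^ 2) ^ s :=
      mul_nonneg (by positivity) (Real.rpow_nonneg hw s)
    have hdx : 0 ≤ x - x0 := by linarith [hxm.1]
    have hP : (0:ℝ) ≤ ((q + 1 : ℕ) : ℝ) := by positivity
    have hRe : 0 ≤ R + e := by linarith
    have main : (A0 + A1 * (x - x0)) * x ≤
        G * (2 * (s + 1) * x * (x + e) - ((q + 1 : ℕ) : ℝ) * (R ^ 2 - (x + e) ^ 2)) := by
      generalize ((q + 1 : ℕ) : ℝ) = P at *
      have h1 : (A0 + A1 * (x - x0)) ≤ G * (2 * (s + 1) * (x0 + e) - P * (R ^ 2 - (x0 + e) ^ 2) / x0)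
          + G * (2 * (s + 1) + P + P * (R + e) / x0) * (x - x0) := by nlinarith
      have h2 := mul_le_mul_of_nonneg_right h1 hxp.le
      refine h2.trans ?_
      have h3 : G * (2 * (s + 1) * x * (x + e) - P * (R ^ 2 - (x + e) ^ 2))
        - (G * (2 * (s + 1) * (x0 + e) - P * (R ^ 2 - (x0 + e) ^ 2) / x0)
          + G * (2 * (s + 1) + P + P * (R + e) / x0) * (x - x0)) * x
          = G * (P * ((x - x0) * ((R + e) * (R - e - x) / x0))) := by
        field_simp
        ring
      have h4 : 0 ≤ G * (P * ((x - x0) * ((R + e) * (R - e - x) / x0))) := by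
        have : 0 ≤ R - e - x := by linarith [hxm.2]
        positivity
      linarith
    have h5 := mul_le_mul_of_nonneg_right main hpos
    calc _ = (A0 + A1 * (x - x0)) * x * (x ^ q * (R ^ 2 - (x + e) ^ 2) ^ s) := by ring
      _ ≤ _ := h5
      _ = _ := by ring
  rw [intervalIntegral.integral_const_mul, key] at hmono
  linarith

lemma lens_lower (m : ℕ) :
    (3/4 : ℝ) ^ (m + 1) * (2 / (2 * m + 5)) ≤ ∫ t in (1/2:ℝ)..1, (1 - t ^ 2) ^ m := by
  have hle : (1/2:ℝ) ≤ 1 := by norm_num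
  have hder : ∀ x ∈ Set.uIcc (1/2:ℝ) 1, HasDerivAt (fun t : ℝ => (1 - t ^ 2) ^ (m + 1) * t⁻¹)
      ((((m + 1 : ℕ) : ℝ) * (1 - x ^ 2) ^ m * (-(2 * x))) * x⁻¹ + (1 - x ^ 2) ^ (m + 1) * (-(x ^ 2)⁻¹)) x := by
    intro x hx
    rw [Set.uIcc_of_le hle] at hx
    have hx0 : x ≠ 0 := by linarith [hx.1]
    have h1 : HasDerivAt (fun t : ℝ => 1 - t ^ 2) (-(2 * x)) x := by
      simpa using ((hasDerivAt_id x).pow 2).const_sub 1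
    have h2 := h1.pow (m + 1)
    simp only [Nat.add_sub_cancel] at h2
    exact h2.mul (hasDerivAt_inv hx0)
  have hcont : ContinuousOn (fun x : ℝ => (((m + 1 : ℕ) : ℝ) * (1 - x ^ 2) ^ m * (-(2 * x))) * x⁻¹ + (1 - x ^ 2) ^ (m + 1) * (-(x ^ 2)⁻¹)) (Set.uIcc (1/2:ℝ) 1) := by
    have : ∀ x ∈ Set.uIcc (1/2:ℝ) 1, x ≠ 0 := by
      intro x hx
      rw [Set.uIcc_of_le hle] at hx
      linarith [hx.1]
    have h2 : ∀ x ∈ Set.uIcc (1/2:ℝ) 1, x ^ 2 ≠ 0 := fun x hx => pow_ne_zero 2 (this x hx)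
    fun_prop (disch := assumption)
  have key := intervalIntegral.integral_eq_sub_of_hasDerivAt hder hcont.intervalIntegrable
  have hmono : (∫ x in (1/2:ℝ)..1, (-(2 * (m:ℝ) + 5)) * (1 - x ^ 2) ^ m) ≤ ∫ x in (1/2:ℝ)..1,
      ((((m + 1 : ℕ) : ℝ) * (1 - x ^ 2) ^ m * (-(2 * x))) * x⁻¹ + (1 - x ^ 2) ^ (m + 1) * (-(x ^ 2)⁻¹)) := by
    apply intervalIntegral.integral_mono_on hle
      ((by fun_prop : Continuous fun x : ℝ => (-(2 * (m:ℝ) + 5)) * (1 - x ^ 2) ^ m).intervalIntegrable _ _) hcont.intervalIntegrable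
    intro x hx
    have hx0 : 0 < x := by linarith [hx.1]
    have hw : 0 ≤ 1 - x ^ 2 := by nlinarith [hx.1, hx.2]
    have hq : (1 - x ^ 2) * (x ^ 2)⁻¹ ≤ 3 := by
      rw [← div_eq_mul_inv, div_le_iff₀ (by positivity)]
      nlinarith [hx.1]
    have hp : 0 ≤ (1 - x ^ 2) ^ m := by positivity
    have : ((((m + 1 : ℕ) : ℝ) * (1 - x ^ 2) ^ m * (-(2 * x))) * x⁻¹ + (1 - x ^ 2) ^ (m + 1) * (-(x ^ 2)⁻¹))
      = (1 - x ^ 2) ^ m * (-(2 * ((m:ℝ) + 1)) - (1 - x ^ 2) * (x ^ 2)⁻¹) := by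
      push_cast
      field_simp
      ring
    rw [this]
    nlinarith
  rw [key, intervalIntegral.integral_const_mul] at hmono
  have h34 : (1 - (1/2:ℝ) ^ 2) = 3/4 := by norm_num
  rw [h34] at hmono
  norm_num at hmono
  rw [← mul_div_assoc, div_le_iff₀ (by positivity)]
  linarith

lemma lens_parts (m : ℕ) (hm : 1 ≤ m) :
    2 * (2 * (m:ℝ)) * (∫ t in (1/2:ℝ)..1, (1 - t ^ 2) ^ (m - 1)) - (3/4 : ℝ) ^ m
      = (2 * (m:ℝ) + 1) * (2 * ∫ t in (1/2:ℝ)..1, (1 - t ^ 2) ^ m) := by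
  obtain ⟨q, rfl⟩ : ∃ q, m = q + 1 := ⟨m - 1, by omega⟩
  simp only [Nat.add_sub_cancel]
  have hder : ∀ x ∈ Set.uIcc (1/2:ℝ) 1, HasDerivAt (fun t : ℝ => t * (1 - t ^ 2) ^ (q + 1))
      (1 * (1 - x ^ 2) ^ (q + 1) + x * (((q + 1 : ℕ) : ℝ) * (1 - x ^ 2) ^ q * (-(2 * x)))) x := by
    intro x hx
    have h1 : HasDerivAt (fun t : ℝ => 1 - t ^ 2) (-(2 * x)) x := by
      simpa using ((hasDerivAt_id x).pow 2).const_sub 1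
    have h2 := h1.pow (q + 1)
    simp only [Nat.add_sub_cancel] at h2
    exact (hasDerivAt_id x).mul h2
  have key := intervalIntegral.integral_eq_sub_of_hasDerivAt hder
    ((by fun_prop : Continuous fun x : ℝ => (1 * (1 - x ^ 2) ^ (q + 1) + x * (((q + 1 : ℕ) : ℝ) * (1 - x ^ 2) ^ q * (-(2 * x))))).intervalIntegrable _ _)
  have : (∫ x in (1/2:ℝ)..1, (1 * (1 - x ^ 2) ^ (q + 1) + x * (((q + 1 : ℕ) : ℝ) * (1 - x ^ 2) ^ q * (-(2 * x)))))
    = ∫ x in (1/2:ℝ)..1, ((2 * (q:ℝ) + 3) * (1 - x ^ 2) ^ (q + 1) - (2 * ((q:ℝ) + 1)) * (1 - x ^ 2) ^ q) := by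
    congr 1
    ext x
    push_cast
    ring
  rw [this, intervalIntegral.integral_sub ((by fun_prop : Continuous fun x : ℝ => (2 * (q:ℝ) + 3) * (1 - x ^ 2) ^ (q + 1)).intervalIntegrable _ _)
    ((by fun_prop : Continuous fun x : ℝ => (2 * ((q:ℝ) + 1)) * (1 - x ^ 2) ^ q).intervalIntegrable _ _),
    intervalIntegral.integral_const_mul, intervalIntegral.integral_const_mul] at key
  have h34 : (1 - (1/2:ℝ) ^ 2) = 3/4 := by norm_num
  rw [h34] at key
  norm_num at key
  push_cast
  linear_combination (-2) * key

lemma sqrt_add_sq_pos (L : ℝ) : 0 < Real.sqrt (1 + L ^ 2) := Real.sqrt_pos.mpr (by positivity)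

lemma trig_rho (L : ℝ) (ha : 0 < Real.sqrt 3 - L) :
    1 / Real.cos (Real.pi / 6 + Real.arctan L) = 2 * Real.sqrt (1 + L ^ 2) / (Real.sqrt 3 - L) := by
  have hc := sqrt_add_sq_pos L
  rw [Real.cos_add, Real.cos_arctan, Real.sin_arctan, Real.cos_pi_div_six, Real.sin_pi_div_six]
  have : Real.sqrt 3 / 2 * (1 / Real.sqrt (1 + L ^ 2)) - 1 / 2 * (L / Real.sqrt (1 + L ^ 2))
    = (Real.sqrt 3 - L) / (2 * Real.sqrt (1 + L ^ 2)) := by field_simp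
  rw [this, one_div_div]

lemma trig_d (L : ℝ) (ha : 0 < Real.sqrt 3 - L) :
    Real.tan (Real.pi / 6 + Real.arctan L) - L = (1 + L ^ 2) / (Real.sqrt 3 - L) := by
  have hc := sqrt_add_sq_pos L
  rw [Real.tan_eq_sin_div_cos, Real.sin_add, Real.cos_add, Real.cos_arctan, Real.sin_arctan,
    Real.cos_pi_div_six, Real.sin_pi_div_six]
  have : Real.sqrt 3 / 2 * (1 / Real.sqrt (1 + L ^ 2)) - 1 / 2 * (L / Real.sqrt (1 + L ^ 2))
    = (Real.sqrt 3 - L) / (2 * Real.sqrt (1 + L ^ 2)) := by field_simp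
  rw [this]
  field_simp
  ring

lemma trig_aux : Real.cos (2 * Real.pi / 3) = -(1/2) ∧ Real.sin (2 * Real.pi / 3) = Real.sqrt 3 / 2 := by
  have : 2 * Real.pi / 3 = Real.pi - Real.pi / 3 := by ring
  rw [this, Real.cos_pi_sub, Real.sin_pi_sub, Real.cos_pi_div_three, Real.sin_pi_div_three]
  exact ⟨rfl, rfl⟩

lemma trig_r (L : ℝ) (hb : 0 < Real.sqrt 3 * L - 1) :
    L / Real.cos (2 * Real.pi / 3 - Real.arctan L)
      = 2 * L * Real.sqrt (1 + L ^ 2) / (Real.sqrt 3 * L - 1) := by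
  have hc := sqrt_add_sq_pos L
  rw [Real.cos_sub, Real.cos_arctan, Real.sin_arctan, trig_aux.1, trig_aux.2]
  have : -(1/2) * (1 / Real.sqrt (1 + L ^ 2)) + Real.sqrt 3 / 2 * (L / Real.sqrt (1 + L ^ 2))
    = (Real.sqrt 3 * L - 1) / (2 * Real.sqrt (1 + L ^ 2)) := by field_simp; ring
  rw [this]
  field_simp

lemma trig_h (L : ℝ) (hb : 0 < Real.sqrt 3 * L - 1) :
    L * Real.tan (2 * Real.pi / 3 - Real.arctan L) - 1 = (1 + L ^ 2) / (Real.sqrt 3 * L - 1) := by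
  have hc := sqrt_add_sq_pos L
  rw [Real.tan_eq_sin_div_cos, Real.sin_sub, Real.cos_sub, Real.cos_arctan, Real.sin_arctan,
    trig_aux.1, trig_aux.2]
  have : -(1/2) * (1 / Real.sqrt (1 + L ^ 2)) + Real.sqrt 3 / 2 * (L / Real.sqrt (1 + L ^ 2))
    = (Real.sqrt 3 * L - 1) / (2 * Real.sqrt (1 + L ^ 2)) := by field_simp; ring
  rw [this]
  obtain ⟨B, hB⟩ : ∃ B, B = Real.sqrt 3 * L - 1 := ⟨_, rfl⟩
  rw [← hB] at hb ⊢
  field_simp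
  rw [hB]
  ring

/-- corner condition -/
lemma corner (μ L : ℝ) (hμ : 2 ≤ μ) (hL : 0 < L) (hL1 : L ≤ 1) :
    1 / (2 * μ + Real.sqrt 3 * L) + L / (2 * μ * L + Real.sqrt 3) ≤ 1 / (μ + 5 / 6) := by
  have h3 : Real.sqrt 3 ^ 2 = 3 := Real.sq_sqrt (by norm_num)
  have h3l : 5/3 ≤ Real.sqrt 3 := Real.le_sqrt_of_sq_le (by norm_num)
  have h3u : Real.sqrt 3 ≤ 9/5 := Real.sqrt_le_iff.mpr ⟨by norm_num, by norm_num⟩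
  generalize Real.sqrt 3 = s at *
  rw [div_add_div _ _ (by positivity) (by positivity), div_le_div_iff₀ (by positivity) (by positivity)]
  have key : 1 * ((2 * μ + s * L) * (2 * μ * L + s)) - (1 * (2 * μ * L + s) + (2 * μ + s * L) * L) * (μ + 5 / 6)
    = s * (μ - 5/6) * (1 - L) ^ 2 + 2 * L * (s * (μ - 5/6)) + s ^ 2 * L - 10/3 * μ * L := by ring
  have h1 : 0 ≤ s * (μ - 5/6) * (1 - L) ^ 2 := by
    have : 0 ≤ μ - 5/6 := by linarith
    positivity
  have h2 : 0 ≤ 2 * (s * (μ - 5/6)) + 3 - 10/3 * μ := by nlinarith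
  have h4 : 0 ≤ L * (2 * (s * (μ - 5/6)) + 3 - 10/3 * μ) := by positivity
  rw [h3] at key
  nlinarith

set_option maxHeartbeats 1000000 in
/-- All the geometric inequalities at the corner. -/
lemma right_cap (j : ℕ) (hj : 1 ≤ j) (μ L c s α a : ℝ) (hμj : μ = j + 1) (hL : 0 < L) (hL1 : L < 1)
    (hμL : μ * L ^ 2 = μ - 1) (hc : 0 < c) (hc2 : c ^ 2 = 1 + L ^ 2) (hs : 0 < s) (hs2 : s ^ 2 = 3)
    (ha : a = s - L) (ha0 : 0 < a) (hα : α = 1 / 2 - 5 / (36 * μ)) :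
    L ≤ 2 * c / a - (1 + L ^ 2) / a ∧ (2 * c / a) ^ 2 - (L + (1 + L ^ 2) / a) ^ 2 = 1 ∧
    (∫ x in L..(2 * c / a - (1 + L ^ 2) / a),
      (c * (2 - 3 * α) / a + c * (s * α / a) * (x - L)) *
        (x ^ j * ((2 * c / a) ^ 2 - (x + (1 + L ^ 2) / a) ^ 2) ^ ((j:ℝ) / 2)))
      ≤ c * (2 - 3 * α) * L ^ j / (2 * μ + s * L) ∧
    (∫ x in L..(2 * c / a - (1 + L ^ 2) / a),
      (s * c ^ 2 / a + (-(c ^ 2 / a)) * (x - L)) *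
        (x ^ j * ((2 * c / a) ^ 2 - (x + (1 + L ^ 2) / a) ^ 2) ^ ((j:ℝ) / 2)))
      ≤ s * c ^ 2 * L ^ j / (2 * μ + s * L) := by
  have hj1 : (1:ℝ) ≤ j := by exact_mod_cast hj
  have hμ2 : 2 ≤ μ := by linarith
  have hα0 : α ≤ 1/2 := by
    have : 0 < 5 / (36 * μ) := by positivity
    linarith
  have hα1 : 0 < α := by
    have : 5 / (36 * μ) ≤ 5/72 := by
      rw [div_le_div_iff₀ (by positivity) (by norm_num)]; linarith
    linarith
  have hx : L ≤ 2 * c / a - (1 + L ^ 2) / a := by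
    rw [← sub_div, le_div_iff₀ ha0, ha]
    have : (1 + s * L) ≤ 2 * c := by
      apply le_of_sq_le_sq _ (by positivity)
      have : (2 * c) ^ 2 - (1 + s * L) ^ 2 = (s - L) ^ 2 := by
        linear_combination 4 * hc2 - (L ^ 2 + 1) * hs2
      nlinarith [sq_nonneg (s - L)]
    linarith
  have hw : (2 * c / a) ^ 2 - (L + (1 + L ^ 2) / a) ^ 2 = 1 := by
    have : L + (1 + L ^ 2) / a = (1 + s * L) / a := by
      field_simp; rw [ha]; ring
    rw [this, div_pow, div_pow, ← sub_div, div_eq_one_iff_eq (by positivity), ha]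
    linear_combination 4 * hc2 - (L ^ 2 + 1) * hs2
  have hT : L + (1 + L ^ 2) / a = (1 + s * L) / a := by
    field_simp; rw [ha]; ring
  have hΦ0 : 2 * ((j:ℝ) / 2 + 1) * (L + (1 + L ^ 2) / a) - j * 1 / L = (2 * μ + s * L) / a := by
    rw [hT]
    have hjμ : (j:ℝ) = μ * L ^ 2 := by linarith
    have : 2 * ((j:ℝ) / 2 + 1) = μ + 1 := by linarith
    rw [this, hjμ]
    field_simp
    rw [ha]
    linear_combination hμL
  have hΦ1 : s / 2 / a ≤ 1/2 / (2 * μ + s * L) * (2 * ((j:ℝ) / 2 + 1) + j + j * (2 * c / a + (1 + L ^ 2) / a) / L) := by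
    have hjμ : (j:ℝ) * (2 * c / a + (1 + L ^ 2) / a) / L = μ * L * (2 * c + (1 + L ^ 2)) / a := by
      have : (j:ℝ) = μ * L ^ 2 := by linarith
      rw [this]; field_simp
    have h2 : 2 * ((j:ℝ) / 2 + 1) + j = 2 * μ := by linarith
    rw [hjμ, h2]
    rw [div_mul_eq_mul_div, div_le_div_iff₀ ha0 (by positivity)]
    have h3 : 1/2 * (2 * μ + μ * L * (2 * c + (1 + L ^ 2)) / a) * a = 1/2 * (2 * μ * a + μ * L * (2 * c + (1 + L ^ 2))) := by
      field_simp
    rw [h3, ha]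
    have hc1 : 1 < c := by
      apply lt_of_pow_lt_pow_left₀ 2 hc.le
      rw [hc2, one_pow]
      linarith [pow_pos hL 2]
    have : 1/2 * (2 * μ * (s - L) + μ * L * (2 * c + (1 + L ^ 2))) - s / 2 * (2 * μ + s * L) 
      = L * (μ * c - 2) := by
      linear_combination (1/2) * L * hμL - L/2 * hs2
    have : 0 ≤ L * (μ * c - 2) := mul_nonneg hL.le (by nlinarith)
    linarith
  have hpos : 0 < 2 * μ + s * L := by positivity
  have hΦ1pos : 0 ≤ (2 * ((j:ℝ) / 2 + 1) + j + j * (2 * c / a + (1 + L ^ 2) / a) / L) := by positivity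
  refine ⟨hx, hw, ?_, ?_⟩
  · have := cap_bound j ((j:ℝ)/2) (2 * c / a) ((1 + L ^ 2) / a) L (c * (2 - 3 * α) / (2 * μ + s * L))
      (c * (2 - 3 * α) / a) (c * (s * α / a)) hj (by positivity) hx hL (by positivity)
      (div_nonneg (mul_nonneg hc.le (by linarith)) hpos.le)
      (by rw [hw, hΦ0]; apply le_of_eq; field_simp)
      (by
        calc c * (s * α / a) ≤ c * (s / 2 / a) := by
              gcongr
              nlinarith
          _ ≤ c * (1/2 / (2 * μ + s * L) * (2 * ((j:ℝ) / 2 + 1) + j + j * (2 * c / a + (1 + L ^ 2) / a) / L)) := by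
              gcongr
          _ = c * (1/2) / (2 * μ + s * L) * (2 * ((j:ℝ) / 2 + 1) + j + j * (2 * c / a + (1 + L ^ 2) / a) / L) := by ring
          _ ≤ _ := by
              gcongr
              linarith)
    refine this.trans (le_of_eq ?_)
    rw [hw, Real.one_rpow]
    ring
  · have := cap_bound j ((j:ℝ)/2) (2 * c / a) ((1 + L ^ 2) / a) L (s * c ^ 2 / (2 * μ + s * L))
      (s * c ^ 2 / a) (-(c ^ 2 / a)) hj (by positivity) hx hL (by positivity)
      (by positivity)
      (by rw [hw, hΦ0]; apply le_of_eq; field_simp)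
      (by
        have h1 : 0 ≤ c ^ 2 / a := by positivity
        have h2 : 0 ≤ s * c ^ 2 / (2 * μ + s * L) * (2 * ((j:ℝ) / 2 + 1) + j + j * (2 * c / a + (1 + L ^ 2) / a) / L) := by positivity
        linarith)
    refine this.trans (le_of_eq ?_)
    rw [hw, Real.one_rpow]
    ring

set_option maxHeartbeats 1000000 in
lemma top_cap (j : ℕ) (hj : 1 ≤ j) (μ L c s α b : ℝ) (hμj : μ = j + 1) (hL : 0 < L) (hL1 : L < 1)
    (hμL : μ * L ^ 2 = μ - 1) (hc : 0 < c) (hc2 : c ^ 2 = 1 + L ^ 2) (hs : 0 < s) (hs2 : s ^ 2 = 3)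
    (hb : b = s * L - 1) (hb0 : 0 < b) (hα : α = 1 / 2 - 5 / (36 * μ)) :
    1 ≤ 2 * L * c / b - (1 + L ^ 2) / b ∧ (2 * L * c / b) ^ 2 - (1 + (1 + L ^ 2) / b) ^ 2 = L ^ 2 ∧
    (∫ x in (1:ℝ)..(2 * L * c / b - (1 + L ^ 2) / b),
      (c * (2 - 3 * α) * L / b + c * (s * α / b) * (x - 1)) *
        (x ^ (j + 1) * ((2 * L * c / b) ^ 2 - (x + (1 + L ^ 2) / b) ^ 2) ^ (((j:ℝ) - 1) / 2)))
      ≤ c * (2 - 3 * α) * L ^ j * (L / (2 * μ * L + s)) ∧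
    (∫ x in (1:ℝ)..(2 * L * c / b - (1 + L ^ 2) / b),
      (s * c ^ 2 * L / b + (-(c ^ 2 / b)) * (x - 1)) *
        (x ^ (j + 1) * ((2 * L * c / b) ^ 2 - (x + (1 + L ^ 2) / b) ^ 2) ^ (((j:ℝ) - 1) / 2)))
      ≤ s * c ^ 2 * L ^ j * (L / (2 * μ * L + s)) := by
  have hj1 : (1:ℝ) ≤ j := by exact_mod_cast hj
  have hμ2 : 2 ≤ μ := by linarith
  have hα0 : α ≤ 1/2 := by
    have : 0 < 5 / (36 * μ) := by positivity
    linarith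
  have hα1 : 0 < α := by
    have : 5 / (36 * μ) ≤ 5/72 := by
      rw [div_le_div_iff₀ (by positivity) (by norm_num)]; linarith
    linarith
  have hα2 : 2 - 3 * α = 1/2 * (1 + 5 / (6 * μ)) := by rw [hα]; field_simp; ring
  have hid : (2 * L * c) ^ 2 - (L * (s + L)) ^ 2 = L ^ 2 * (s * L - 1) ^ 2 := by
    linear_combination 4 * L ^ 2 * hc2 - (L ^ 2 + L ^ 4) * hs2
  have hx : 1 ≤ 2 * L * c / b - (1 + L ^ 2) / b := by
    rw [← sub_div, le_div_iff₀ hb0, hb]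
    have : L * (s + L) ≤ 2 * L * c := by
      apply le_of_sq_le_sq _ (by positivity)
      nlinarith [mul_nonneg (sq_nonneg L) (sq_nonneg (s * L - 1))]
    linarith
  have hT : 1 + (1 + L ^ 2) / b = L * (s + L) / b := by
    field_simp; rw [hb]; ring
  have hw : (2 * L * c / b) ^ 2 - (1 + (1 + L ^ 2) / b) ^ 2 = L ^ 2 := by
    rw [hT, div_pow, div_pow, ← sub_div, div_eq_iff (by positivity), hb]
    exact hid
  have hN : 2 * (((j:ℝ) - 1) / 2 + 1) = μ := by linarith
  have hp : ((j + 1 : ℕ) : ℝ) = μ := by push_cast; linarith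
  have hΦ0 : μ * (1 + (1 + L ^ 2) / b) - μ * L ^ 2 / 1 = L * (2 * μ * L + s) / b := by
    rw [hT]
    field_simp
    rw [hb]
    linear_combination (-s) * hμL
  have hmlc : 17/10 ≤ μ * L * c := by
    apply le_of_sq_le_sq _ (by positivity)
    have : (μ * L * c) ^ 2 = (μ - 1) * (2 * μ - 1) := by
      rw [mul_pow, hc2]
      linear_combination (μ + μ * L ^ 2 + (μ - 1)) * hμL
    rw [this]; nlinarith
  have hL7 : 7/10 ≤ L := by
    apply le_of_sq_le_sq _ hL.le
    nlinarith
  have hs17 : 17/10 ≤ s := by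
    apply le_of_sq_le_sq _ hs.le
    nlinarith
  have hΦ1 : s / 2 / b ≤ 1/2 * (1 + 5 / (6 * μ)) / (2 * μ * L + s) * (μ + μ + μ * (2 * L * c / b + (1 + L ^ 2) / b) / 1) := by
    rw [div_mul_eq_mul_div, div_le_div_iff₀ hb0 (by positivity)]
    have h3 : 1/2 * (1 + 5 / (6 * μ)) * (μ + μ + μ * (2 * L * c / b + (1 + L ^ 2) / b) / 1) * b
       = 1/2 * ((2 * b + (2 * L * c + (1 + L ^ 2))) * μ + 5/6 * (2 * b + (2 * L * c + (1 + L ^ 2)))) := by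
      field_simp
      ring
    rw [h3, hb]
    have h4 : (2 * (s * L - 1) + (2 * L * c + (1 + L ^ 2))) * μ = 2 * s * μ * L - 1 + 2 * (μ * L * c) := by
      linear_combination hμL
    rw [h4]
    have hc1 : 1 < c := by
      apply lt_of_pow_lt_pow_left₀ 2 hc.le
      rw [hc2, one_pow]
      linarith [pow_pos hL 2]
    have h5 : 17/10 * (7/10) ≤ s * L := mul_le_mul hs17 hL7 (by norm_num) hs.le
    have h6 : L * 1 < L * c := mul_lt_mul_of_pos_left hc1 hL
    have h7 : 0 ≤ L ^ 2 := sq_nonneg L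
    have h8 : s / 2 * (2 * μ * L + s) = s * μ * L + 3/2 := by linear_combination (1/2) * hs2
    rw [h8]
    linarith
  have hpos : 0 < 2 * μ * L + s := by positivity
  have hΦ1pos : 0 ≤ (μ + μ + μ * (2 * L * c / b + (1 + L ^ 2) / b) / 1) := by positivity
  have hLp : (L ^ 2) ^ (((j:ℝ) - 1) / 2 + 1) = L ^ j * L := by
    rw [← pow_succ, ← Real.rpow_natCast L 2, ← Real.rpow_mul hL.le, ← Real.rpow_natCast L (j + 1)]
    congr 1
    push_cast; ring
  refine ⟨hx, hw, ?_, ?_⟩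
  · have := cap_bound (j + 1) (((j:ℝ) - 1)/2) (2 * L * c / b) ((1 + L ^ 2) / b) 1 (c * (2 - 3 * α) / (2 * μ * L + s))
      (c * (2 - 3 * α) * L / b) (c * (s * α / b)) (by omega) (by linarith) hx one_pos (by positivity)
      (div_nonneg (mul_nonneg hc.le (by linarith)) hpos.le)
      (by rw [hw, hN, hp, hΦ0]; apply le_of_eq; field_simp)
      (by
        rw [hN, hp, hα2]
        calc c * (s * α / b) ≤ c * (s / 2 / b) := by
              gcongr
              nlinarith
          _ ≤ c * (1/2 * (1 + 5 / (6 * μ)) / (2 * μ * L + s) * (μ + μ + μ * (2 * L * c / b + (1 + L ^ 2) / b) / 1)) := by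
              gcongr
          _ = _ := by ring)
    refine this.trans (le_of_eq ?_)
    rw [hw, hLp, one_pow]
    ring
  · have := cap_bound (j + 1) (((j:ℝ) - 1)/2) (2 * L * c / b) ((1 + L ^ 2) / b) 1 (s * c ^ 2 / (2 * μ * L + s))
      (s * c ^ 2 * L / b) (-(c ^ 2 / b)) (by omega) (by linarith) hx one_pos (by positivity)
      (by positivity)
      (by rw [hw, hN, hp, hΦ0]; apply le_of_eq; field_simp)
      (by
        rw [hN, hp]
        have h1 : 0 ≤ c ^ 2 / b := by positivity
        have h2 : 0 ≤ s * c ^ 2 / (2 * μ * L + s) * (μ + μ + μ * (2 * L * c / b + (1 + L ^ 2) / b) / 1) := by positivity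
        linarith)
    refine this.trans (le_of_eq ?_)
    rw [hw, hLp, one_pow]
    ring

set_option maxHeartbeats 1000000 in
lemma core (j : ℕ) (hj : 1 ≤ j) (μ L c s a b κ ρ d r h I1 I2 V1 V2 : ℝ)
    (hμj : μ = j + 1) (hL : 0 < L) (hL1 : L < 1)
    (hμL : μ * L ^ 2 = μ - 1) (hc : 0 < c) (hc2 : c ^ 2 = 1 + L ^ 2) (hs : 0 < s) (hs2 : s ^ 2 = 3)
    (ha : a = s - L) (ha0 : 0 < a) (hb : b = s * L - 1) (hb0 : 0 < b)
    (hκ : κ = s * (1 / 2 - 5 / (36 * μ)) / c)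
    (hρ : ρ = 2 * c / a) (hd : d = (1 + L ^ 2) / a) (hr : r = 2 * L * c / b) (hh : h = (1 + L ^ 2) / b)
    (hcorner : 1 / (2 * μ + s * L) + L / (2 * μ * L + s) ≤ 1 / (μ + 5 / 6))
    (hI1 : I1 = ∫ u in L..(ρ - d), u ^ j * (ρ ^ 2 - (u + d) ^ 2) ^ ((j:ℝ) / 2))
    (hI2 : I2 = ∫ v in (1:ℝ)..(r - h), v ^ (j + 1) * (r ^ 2 - (v + h) ^ 2) ^ (((j:ℝ) - 1) / 2))
    (hV1 : V1 = ∫ u in L..(ρ - d), u ^ j * (ρ ^ 2 - (u + d) ^ 2) ^ ((j:ℝ) / 2 + 1))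
    (hV2 : V2 = ∫ v in (1:ℝ)..(r - h), v ^ (j + 1) * (r ^ 2 - (v + h) ^ 2) ^ (((j:ℝ) - 1) / 2 + 1)) :
    0 < L ^ (j + 1) + μ * V1 + (μ + 1) * V2 ∧
    μ * (μ + 1) * (ρ * I1 + r * I2) - μ * (μ + 1) * L ^ j * c / (2 * μ)
      ≤ κ * ((2 * μ + 1) * (L ^ (j + 1) + μ * V1 + (μ + 1) * V2)) ∧
    (2 * μ + 1) * (L ^ (j + 1) + μ * V1 + (μ + 1) * V2) ≤ μ * (μ + 1) * (s * c ^ 2 * L ^ j / (μ + 5 / 6)) := by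
  have hj1 : (1:ℝ) ≤ j := by exact_mod_cast hj
  have hμ2 : 2 ≤ μ := by linarith
  obtain ⟨α, hα⟩ : ∃ α : ℝ, α = 1 / 2 - 5 / (36 * μ) := ⟨_, rfl⟩
  obtain ⟨x1, w1, e1, f1⟩ := right_cap j hj μ L c s α a hμj hL hL1 hμL hc hc2 hs hs2 ha ha0 hα
  obtain ⟨x2, w2, e2, f2⟩ := top_cap j hj μ L c s α b hμj hL hL1 hμL hc hc2 hs hs2 hb hb0 hα
  rw [← hα] at hκ
  rw [← hρ, ← hd] at x1 w1 e1 f1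
  rw [← hr, ← hh] at x2 w2 e2 f2
  have hd0 : 0 ≤ d := by rw [hd]; positivity
  have hh0 : 0 ≤ h := by rw [hh]; positivity
  have p1 := cap_parts j ((j:ℝ)/2) ρ d L (by positivity) x1 hL hd0
  have p2 := cap_parts (j + 1) (((j:ℝ) - 1)/2) r h 1 (by linarith) x2 one_pos hh0
  obtain ⟨K1, hK1⟩ : ∃ K : ℝ, K = ∫ x in L..(ρ - d), (ρ ^ 2 - d * (x + d)) * (x ^ j * (ρ ^ 2 - (x + d) ^ 2) ^ ((j:ℝ)/2)) := ⟨_, rfl⟩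
  obtain ⟨K2, hK2⟩ : ∃ K : ℝ, K = ∫ x in (1:ℝ)..(r - h), (r ^ 2 - h * (x + h)) * (x ^ (j + 1) * (r ^ 2 - (x + h) ^ 2) ^ (((j:ℝ) - 1)/2)) := ⟨_, rfl⟩
  have hLp : (L ^ 2) ^ (((j:ℝ) - 1) / 2 + 1) = L ^ (j + 1) := by
    rw [← Real.rpow_natCast L 2, ← Real.rpow_mul hL.le, ← Real.rpow_natCast L (j + 1)]
    congr 1
    push_cast; ring
  rw [← hV1, ← hK1, w1, Real.one_rpow] at p1
  rw [← hV2, ← hK2, w2, hLp, one_pow] at p2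
  push_cast at p2
  have q1 : (2 * μ + 1) * (μ * V1) = μ * (μ + 1) * K1 - μ * L ^ (j + 1) := by
    rw [hμj]; linear_combination p1
  have q2 : (2 * μ + 1) * ((μ + 1) * V2) = μ * (μ + 1) * K2 - (μ + 1) * L ^ (j + 1) := by
    rw [hμj]; linear_combination p2
  have qW : (2 * μ + 1) * (L ^ (j + 1) + μ * V1 + (μ + 1) * V2) = μ * (μ + 1) * (K1 + K2) := by
    linear_combination q1 + q2
  have lin1 : ∀ x : ℝ, s * c ^ 2 / a + (-(c ^ 2 / a)) * (x - L) = ρ ^ 2 - d * (x + d) := by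
    intro x
    rw [hρ, hd, ← hc2]
    field_simp
    rw [ha]
    linear_combination hs2 + hc2
  have lin2 : ∀ x : ℝ, s * c ^ 2 * L / b + (-(c ^ 2 / b)) * (x - 1) = r ^ 2 - h * (x + h) := by
    intro x
    rw [hr, hh, ← hc2]
    field_simp
    rw [hb]
    linear_combination L ^ 2 * hs2 + hc2
  have lin1' : ∀ x : ℝ, c * (2 - 3 * α) / a + c * (s * α / a) * (x - L) = ρ - κ * (ρ ^ 2 - d * (x + d)) := by
    intro x
    rw [← lin1, hκ, hρ]
    field_simp
    linear_combination α * hs2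
  have lin2' : ∀ x : ℝ, c * (2 - 3 * α) * L / b + c * (s * α / b) * (x - 1) = r - κ * (r ^ 2 - h * (x + h)) := by
    intro x
    rw [← lin2, hκ, hr]
    field_simp
    linear_combination L * α * hs2
  have c1 := cap_cont j ((j:ℝ)/2) ρ d (by positivity)
  have c2 := cap_cont (j + 1) (((j:ℝ)-1)/2) r h (by linarith)
  have c1' : Continuous (fun x : ℝ => (ρ ^ 2 - d * (x + d)) * (x ^ j * (ρ ^ 2 - (x + d) ^ 2) ^ ((j:ℝ)/2))) :=
    Continuous.mul (by fun_prop) c1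
  have c2' : Continuous (fun x : ℝ => (r ^ 2 - h * (x + h)) * (x ^ (j + 1) * (r ^ 2 - (x + h) ^ 2) ^ (((j:ℝ) - 1)/2))) :=
    Continuous.mul (by fun_prop) c2
  simp only [lin1', sub_mul, mul_assoc κ] at e1
  simp only [lin2', sub_mul, mul_assoc κ] at e2
  simp only [lin1] at f1
  simp only [lin2] at f2
  rw [← hK1] at f1
  rw [← hK2] at f2
  simp only [← sub_mul] at e1 e2
  rw [intervalIntegral.integral_sub ((c1.const_mul _).intervalIntegrable _ _) ((c1'.const_mul _).intervalIntegrable _ _),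
    intervalIntegral.integral_const_mul, intervalIntegral.integral_const_mul, ← hI1, ← hK1] at e1
  rw [intervalIntegral.integral_sub ((c2.const_mul _).intervalIntegrable _ _) ((c2'.const_mul _).intervalIntegrable _ _),
    intervalIntegral.integral_const_mul, intervalIntegral.integral_const_mul, ← hI2, ← hK2] at e2
  have hα2 : 2 - 3 * α = (μ + 5 / 6) / (2 * μ) := by rw [hα]; field_simp; ring
  have hLj : 0 < L ^ j := pow_pos hL j
  refine ⟨?_, ?_, ?_⟩
  · have v1 : 0 ≤ V1 := by
      rw [hV1]
      apply intervalIntegral.integral_nonneg x1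
      intro x hx
      have : 0 ≤ x := hL.le.trans hx.1
      have he : 0 ≤ d := by rw [hd]; positivity
      have hxR : x + d ≤ ρ := by linarith [hx.2]
      exact mul_nonneg (by positivity)
        (Real.rpow_nonneg (sub_nonneg.mpr (pow_le_pow_left₀ (add_nonneg this he) hxR 2)) _)
    have v2 : 0 ≤ V2 := by
      rw [hV2]
      apply intervalIntegral.integral_nonneg x2
      intro x hx
      have : 0 ≤ x := zero_le_one.trans hx.1
      have he : 0 ≤ h := by rw [hh]; positivity
      have hxR : x + h ≤ r := by linarith [hx.2]
      exact mul_nonneg (by positivity)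
        (Real.rpow_nonneg (sub_nonneg.mpr (pow_le_pow_left₀ (add_nonneg this he) hxR 2)) _)
    positivity
  · rw [qW]
    have h1 : ρ * I1 - κ * K1 + (r * I2 - κ * K2) ≤ L ^ j * c / (2 * μ) := by
      calc ρ * I1 - κ * K1 + (r * I2 - κ * K2) ≤ c * (2 - 3 * α) * L ^ j / (2 * μ + s * L)
            + c * (2 - 3 * α) * L ^ j * (L / (2 * μ * L + s)) := add_le_add e1 e2
        _ = c * (2 - 3 * α) * L ^ j * (1 / (2 * μ + s * L) + L / (2 * μ * L + s)) := by ring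
        _ ≤ c * (2 - 3 * α) * L ^ j * (1 / (μ + 5 / 6)) := by
            apply mul_le_mul_of_nonneg_left hcorner
            rw [hα2]; positivity
        _ = L ^ j * c / (2 * μ) := by rw [hα2]; field_simp
    have h2 : 0 ≤ μ * (μ + 1) := by positivity
    have h3 := mul_le_mul_of_nonneg_left h1 h2
    have h4 : μ * (μ + 1) * L ^ j * c / (2 * μ) = μ * (μ + 1) * (L ^ j * c / (2 * μ)) := by ring
    rw [h4]
    linarith
  · rw [qW]
    apply mul_le_mul_of_nonneg_left _ (by positivity)
    calc K1 + K2 ≤ s * c ^ 2 * L ^ j / (2 * μ + s * L) + s * c ^ 2 * L ^ j * (L / (2 * μ * L + s)) := add_le_add f1 f2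
      _ = s * c ^ 2 * L ^ j * (1 / (2 * μ + s * L) + L / (2 * μ * L + s)) := by ring
      _ ≤ s * c ^ 2 * L ^ j * (1 / (μ + 5 / 6)) := by
          apply mul_le_mul_of_nonneg_left hcorner (by positivity)
      _ = _ := by ring

/-- the final scalar inequality, squared -/
lemma final_sq (j : ℕ) (hj : 1 ≤ j) (μ L : ℝ) (hμj : μ = j + 1) (hL : 0 < L)
    (hμL : μ * L ^ 2 = μ - 1) :
    Real.sqrt 2 * L ^ j * ((2 * μ - 1) * (2 * μ + 5)) < (2 * μ + 1) * (2 * μ + 5 / 3) := by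
  have hj1 : (1:ℝ) ≤ j := by exact_mod_cast hj
  have hμ2 : 2 ≤ μ := by linarith
  have hb : 2 + ((j:ℝ) - 1) / (2 * j) ≤ (1 + 1 / (j:ℝ)) ^ j := by
    clear hμL hμj hμ2
    rw [add_comm (1:ℝ), add_pow]
    simp only [one_pow, mul_one]
    rcases Nat.lt_or_ge j 2 with h | h
    · have : j = 1 := by omega
      subst this
      norm_num [Finset.sum_range_succ]
    · have hsub : Finset.range 3 ⊆ Finset.range (j + 1) := by
        apply Finset.range_subset_range.mpr; omega
      have := Finset.sum_le_sum_of_subset_of_nonneg (f := fun i => (1 / (j:ℝ)) ^ i * (j.choose i : ℝ)) hsub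
        (fun i _ _ => by positivity)
      refine le_trans (le_of_eq ?_) this
      simp only [Finset.sum_range_succ, Finset.sum_range_zero, Nat.choose_zero_right, Nat.choose_one_right, Nat.cast_choose_two]
      field_simp
      ring
  have hLj : (L ^ j) ^ 2 * (1 + 1 / (j:ℝ)) ^ j = 1 := by
    rw [← pow_mul, mul_comm j 2, pow_mul, ← mul_pow]
    have : L ^ 2 * (1 + 1 / (j:ℝ)) = 1 := by
      have h1 : (j:ℝ) = μ - 1 := by linarith
      have h2 : L ^ 2 = (μ - 1) / μ := by field_simp; linarith
      have h3 : μ - 1 ≠ 0 := by linarith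
      rw [h1, h2]; field_simp; ring
    rw [this, one_pow]
  have h1 : (L ^ j) ^ 2 * (2 + ((j:ℝ) - 1) / (2 * j)) ≤ 1 := by
    exact (mul_le_mul_of_nonneg_left hb (by positivity)).trans hLj.le
  have h2 : (L ^ j) ^ 2 * (5 * μ - 6) ≤ 2 * (μ - 1) := by
    have : (2 + ((j:ℝ) - 1) / (2 * j)) = (5 * μ - 6) / (2 * (μ - 1)) := by
      have h1 : (j:ℝ) = μ - 1 := by linarith
      have h3 : μ - 1 ≠ 0 := by linarith
      rw [h1]; field_simp; ring
    rw [this, ← mul_div_assoc, div_le_one (by linarith)] at h1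
    exact h1
  have hpos : 0 < (2 * μ + 1) * (2 * μ + 5 / 3) := by positivity
  apply lt_of_pow_lt_pow_left₀ 2 hpos.le
  rw [mul_pow, mul_pow, Real.sq_sqrt (by norm_num)]
  have h56 : 0 < 5 * μ - 6 := by linarith
  have h3 : (4 * (μ - 1)) * ((2 * μ - 1) * (2 * μ + 5)) ^ 2 < (5 * μ - 6) * ((2 * μ + 1) * (2 * μ + 5 / 3)) ^ 2 := by
    obtain ⟨t, rfl⟩ : ∃ t, μ = t + 2 := ⟨μ - 2, by ring⟩
    have ht : 0 ≤ t := by linarith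
    have : 0 < (5 * (t + 2) - 6) * ((2 * (t + 2) + 1) * (2 * (t + 2) + 5 / 3)) ^ 2 - (4 * ((t + 2) - 1)) * ((2 * (t + 2) - 1) * (2 * (t + 2) + 5)) ^ 2 := by
      ring_nf
      positivity
    linarith
  have h4 := mul_le_mul_of_nonneg_right h2 (by positivity : 0 ≤ 2 * ((2 * μ - 1) * (2 * μ + 5)) ^ 2)
  have h5 : (2 * (L ^ j) ^ 2 * ((2 * μ - 1) * (2 * μ + 5)) ^ 2) * (5 * μ - 6) < ((2 * μ + 1) * (2 * μ + 5 / 3)) ^ 2 * (5 * μ - 6) := by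
    linarith
  exact lt_of_mul_lt_mul_right h5 h56.le

lemma omega_prod (j : ℕ) :
    Real.pi ^ (((j:ℝ) + 1)/2) / Real.Gamma (((j:ℝ) + 1)/2 + 1) *
      (Real.pi ^ ((((j + 1 : ℕ):ℝ) + 1)/2) / Real.Gamma ((((j + 1 : ℕ):ℝ) + 1)/2 + 1))
      = Real.pi ^ (j + 1) * 2 ^ (j + 2) / ((j + 2).factorial : ℝ) := by
  have hG := Real.Gamma_mul_Gamma_add_half (((j:ℝ) + 1)/2 + 1)
  have e1 : ((j:ℝ) + 1)/2 + 1 + 1/2 = (((j + 1 : ℕ):ℝ) + 1)/2 + 1 := by push_cast; ring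
  have e2 : 2 * (((j:ℝ) + 1)/2 + 1) = ((j + 2 : ℕ) : ℝ) + 1 := by push_cast; ring
  rw [e1, e2, Real.Gamma_nat_eq_factorial] at hG
  have e3 : (1:ℝ) - (((j + 2 : ℕ) : ℝ) + 1) = -((j + 2 : ℕ) : ℝ) := by ring
  rw [e3, Real.rpow_neg (by norm_num), Real.rpow_natCast] at hG
  rw [div_mul_div_comm, hG, ← Real.rpow_add Real.pi_pos]
  have e4 : ((j:ℝ) + 1)/2 + (((j + 1 : ℕ):ℝ) + 1)/2 = ((j + 1 : ℕ) : ℝ) + 1/2 := by push_cast; ring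
  rw [e4, Real.rpow_add Real.pi_pos, Real.rpow_natCast, ← Real.sqrt_eq_rpow]
  have hpi : 0 < Real.sqrt Real.pi := Real.sqrt_pos.mpr Real.pi_pos
  have hf : (0:ℝ) < ((j + 2).factorial : ℝ) := by exact_mod_cast Nat.factorial_pos _
  field_simp

lemma self_div_rpow (X N : ℝ) (hX : 0 < X) (hN : 0 < N) : X / X ^ ((N - 1) / N) = X ^ (1 / N) := by
  rw [div_eq_iff (Real.rpow_pos_of_pos hX _).ne', ← Real.rpow_add hX]
  have : 1 / N + (N - 1) / N = 1 := by field_simp; ring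
  rw [this, Real.rpow_one]

lemma lambdaPlane_eq (j : ℕ) (J : ℝ) (hJ : J = ∫ t in (1/2:ℝ)..1, (1 - t ^ 2) ^ (j + 1)) :
    lambdaPlane (2 * (j + 1) + 1) =
      (2 * ((j:ℝ) + 1) + 1) * (2 * (Real.pi ^ (j + 1) / ((j + 1).factorial : ℝ)) * J) ^ (1 / (2 * ((j:ℝ) + 1) + 1)) := by
  have hJ0 : 0 < J := by
    rw [hJ]
    refine lt_of_lt_of_le ?_ (lens_lower (j + 1))
    positivity
  have hp := lens_parts (j + 1) (by omega)
  simp only [Nat.add_sub_cancel] at hp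
  rw [← hJ] at hp
  unfold lambdaPlane
  have a1 : (((2 * (j + 1) + 1 : ℕ):ℝ) - 1) / 2 = ((j + 1 : ℕ) : ℝ) := by push_cast; ring
  have a2 : (((2 * (j + 1) + 1 : ℕ):ℝ) + 1) / 2 = ((j + 1 : ℕ) : ℝ) + 1 := by push_cast; ring
  have a3 : (((2 * (j + 1) + 1 : ℕ):ℝ) - 3) / 2 = (j : ℝ) := by push_cast; ring
  have a4 : (Real.sqrt 3 / 2) ^ (((2 * (j + 1) + 1 : ℕ):ℝ) - 1) = (3/4) ^ (j + 1) := by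
    have : ((2 * (j + 1) + 1 : ℕ):ℝ) - 1 = ((2 * (j + 1) : ℕ) : ℝ) := by push_cast; ring
    rw [this, Real.rpow_natCast, pow_mul, div_pow, Real.sq_sqrt (by norm_num)]
    norm_num
  simp only [a1, a2, a3, a4, Real.rpow_natCast, Real.Gamma_nat_eq_factorial]
  rw [← hJ]
  have hf : (0:ℝ) < ((j + 1).factorial : ℝ) := by exact_mod_cast Nat.factorial_pos _
  have hω : 0 < Real.pi ^ (j + 1) / ((j + 1).factorial : ℝ) := by positivity
  generalize Real.pi ^ (j + 1) / ((j + 1).factorial : ℝ) = ω at *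
  have hn : ((2 * (j + 1) + 1 : ℕ):ℝ) = 2 * ((j:ℝ) + 1) + 1 := by push_cast; ring
  rw [hn]
  push_cast at hp
  have hnum : 2 * (2 * ((j:ℝ) + 1) + 1 - 1) * ω * (∫ t in (1/2:ℝ)..1, (1 - t ^ 2) ^ j) - ω * (3/4) ^ (j + 1)
    = (2 * ((j:ℝ) + 1) + 1) * (2 * ω * J) := by
    linear_combination ω * hp
  rw [hnum, mul_div_assoc, self_div_rpow _ _ (by positivity) (by positivity)]

set_option maxHeartbeats 1000000 in
lemma main_ineq (j : ℕ) (hj : 1 ≤ j) :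
    lawsonCompetitorEnergy j (j + 1) < lambdaPlane (2 * (j + 1) + 1) := by
  have hj1 : (1:ℝ) ≤ j := by exact_mod_cast hj
  obtain ⟨J, hJ⟩ : ∃ J : ℝ, J = ∫ t in (1/2:ℝ)..1, (1 - t ^ 2) ^ (j + 1) := ⟨_, rfl⟩
  have hJl := lens_lower (j + 1)
  rw [← hJ] at hJl
  rw [lambdaPlane_eq j J hJ]
  obtain ⟨μ, hμj⟩ : ∃ μ : ℝ, μ = j + 1 := ⟨_, rfl⟩
  have hμ2 : 2 ≤ μ := by linarith
  obtain ⟨L, hLdef⟩ : ∃ L : ℝ, L = Real.sqrt ((j:ℝ) / ((j + 1 : ℕ) : ℝ)) := ⟨_, rfl⟩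
  have hL : 0 < L := by rw [hLdef]; apply Real.sqrt_pos.mpr; positivity
  have hμL : μ * L ^ 2 = μ - 1 := by
    rw [hLdef, Real.sq_sqrt (by positivity), hμj]
    push_cast
    field_simp
    ring
  have hL1 : L < 1 := by
    by_contra hcon
    have hcon2 : 1 ≤ L := not_lt.mp hcon
    have hcon3 : 1 ≤ L ^ 2 := one_le_pow₀ hcon2
    clear * - hcon3 hμL hμ2
    nlinarith
  have hs : 0 < Real.sqrt 3 := by positivity
  have hs2 : Real.sqrt 3 ^ 2 = 3 := Real.sq_sqrt (by norm_num)
  have hs17 : 17/10 ≤ Real.sqrt 3 := Real.le_sqrt_of_sq_le (by norm_num)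
  have hL7 : 7/10 ≤ L := by
    apply le_of_sq_le_sq _ hL.le
    clear * - hμL hμ2
    nlinarith
  have ha0 : 0 < Real.sqrt 3 - L := by linarith
  have hb0 : 0 < Real.sqrt 3 * L - 1 := by
    clear * - hL7 hs17
    nlinarith
  have hcorner := corner μ L hμ2 hL hL1.le
  have hfin := final_sq j hj μ L hμj hL hμL
  unfold lawsonCompetitorEnergy
  simp only
  rw [← hLdef, trig_rho L ha0, trig_d L ha0, trig_r L hb0, trig_h L hb0]
  have hc := sqrt_add_sq_pos L
  have hc2 : Real.sqrt (1 + L ^ 2) ^ 2 = 1 + L ^ 2 := Real.sq_sqrt (by positivity)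
  generalize Real.sqrt (1 + L ^ 2) = c at *
  have hω := omega_prod j
  obtain ⟨ω1, h1⟩ : ∃ ω : ℝ, ω = Real.pi ^ (((j:ℝ) + 1)/2) / Real.Gamma (((j:ℝ) + 1)/2 + 1) := ⟨_, rfl⟩
  obtain ⟨ω2, h2⟩ : ∃ ω : ℝ, ω = (Real.pi ^ ((((j + 1 : ℕ):ℝ) + 1)/2) / Real.Gamma ((((j + 1 : ℕ):ℝ) + 1)/2 + 1)) := ⟨_, rfl⟩
  rw [← h1, ← h2] at hω ⊢
  have x1 : (((j + 1 : ℕ):ℝ) + 1)/2 = (j:ℝ)/2 + 1 := by push_cast; ring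
  have x2 : ((j:ℝ) + 1)/2 = ((j:ℝ) - 1)/2 + 1 := by ring
  have x3 : (((j + 1 : ℕ):ℝ) - 1)/2 = (j:ℝ)/2 := by push_cast; ring
  rw [x1, x2, x3]
  generalize hρ : 2 * c / (Real.sqrt 3 - L) = ρ
  generalize hd : (1 + L ^ 2) / (Real.sqrt 3 - L) = d
  generalize hr : 2 * L * c / (Real.sqrt 3 * L - 1) = r
  generalize hh : (1 + L ^ 2) / (Real.sqrt 3 * L - 1) = h
  generalize hI1 : (∫ u in L..(ρ - d), u ^ j * (ρ ^ 2 - (u + d) ^ 2) ^ ((j:ℝ) / 2)) = I1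
  generalize hI2 : (∫ v in (1:ℝ)..(r - h), v ^ (j + 1) * (r ^ 2 - (v + h) ^ 2) ^ (((j:ℝ) - 1) / 2)) = I2
  generalize hV1 : (∫ u in L..(ρ - d), u ^ j * (ρ ^ 2 - (u + d) ^ 2) ^ ((j:ℝ) / 2 + 1)) = V1
  generalize hV2 : (∫ v in (1:ℝ)..(r - h), v ^ (j + 1) * (r ^ 2 - (v + h) ^ 2) ^ (((j:ℝ) - 1) / 2 + 1)) = V2
  obtain ⟨κ, hκ⟩ : ∃ κ : ℝ, κ = Real.sqrt 3 * (1 / 2 - 5 / (36 * μ)) / c := ⟨_, rfl⟩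
  obtain ⟨hW, hE, hWu⟩ := core j hj μ L c (Real.sqrt 3) _ _ κ ρ d r h I1 I2 V1 V2 hμj hL hL1 hμL hc hc2 hs hs2
    rfl ha0 rfl hb0 hκ hρ.symm hd.symm hr.symm hh.symm hcorner hI1.symm hI2.symm hV1.symm hV2.symm
  have hμ' : ((j + 1 : ℕ):ℝ) = μ := by rw [hμj]; push_cast; ring
  have hjμ : (j:ℝ) = μ - 1 := by linarith
  rw [hμ', hjμ]
  have y1 : μ - 1 + 1 = μ := by ring
  have y2 : μ - 1 + μ + 2 = 2 * μ + 1 := by ring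
  have y3 : μ - 1 + μ + 1 = 2 * μ := by ring
  rw [y1, y2, y3]
  obtain ⟨W, hWd⟩ : ∃ W : ℝ, W = L ^ (j + 1) + μ * V1 + (μ + 1) * V2 := ⟨_, rfl⟩
  rw [← hWd] at hW hE hWu ⊢
  have hΩ : 0 < ω1 * ω2 := by rw [hω]; positivity
  generalize hΩd : ω1 * ω2 = Ω at *
  have hX : 0 < Ω * W := by positivity
  -- κ ≤ k0
  have hk0 : κ ≤ Real.sqrt 3 * Real.sqrt 2 / 4 := by
    have h22 : Real.sqrt 2 ^ 2 = 2 := Real.sq_sqrt (by norm_num)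
    apply le_of_sq_le_sq _ (by positivity)
    rw [hκ, div_pow, mul_pow, div_pow, mul_pow, hs2, h22, div_le_iff₀ (by positivity)]
    have hcμ : c ^ 2 = 2 - 1 / μ := by
      rw [hc2]; field_simp; linarith
    rw [hcμ]
    obtain ⟨t, ht⟩ : ∃ t : ℝ, t = 1 / μ := ⟨_, rfl⟩
    have ht2 : t ≤ 1/2 := by
      rw [ht]; exact one_div_le_one_div_of_le (by norm_num) hμ2
    have ht0 : 0 < t := by rw [ht]; positivity
    have : 5 / (36 * μ) = 5/36 * t := by rw [ht]; field_simp
    rw [this, ← ht]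
    clear * - ht0 ht2
    nlinarith
  obtain ⟨k0, hk0d⟩ : ∃ k : ℝ, k = Real.sqrt 3 * Real.sqrt 2 / 4 := ⟨_, rfl⟩
  have hk0p : 0 < k0 := by rw [hk0d]; positivity
  have hk0s : k0 ^ 2 = 3/8 := by
    rw [hk0d, div_pow, mul_pow, hs2, Real.sq_sqrt (by norm_num)]; norm_num
  rw [← hk0d] at hk0
  -- bound M
  have hM : (Ω * μ * (μ + 1) * (ρ * I1 + r * I2) - Ω * μ * (μ + 1) * L ^ j * c / (2 * μ)) /
      (Ω * W) ^ ((2 * μ + 1 - 1) / (2 * μ + 1)) ≤ (2 * μ + 1) * (k0 * (Ω * W) ^ (1 / (2 * μ + 1))) := by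
    have hnum : (Ω * μ * (μ + 1) * (ρ * I1 + r * I2) - Ω * μ * (μ + 1) * L ^ j * c / (2 * μ))
        ≤ (2 * μ + 1) * k0 * (Ω * W) := by
      calc _ = Ω * (μ * (μ + 1) * (ρ * I1 + r * I2) - μ * (μ + 1) * L ^ j * c / (2 * μ)) := by ring
        _ ≤ Ω * (κ * ((2 * μ + 1) * W)) := mul_le_mul_of_nonneg_left hE hΩ.le
        _ ≤ Ω * (k0 * ((2 * μ + 1) * W)) := by gcongr
        _ = _ := by ring
    calc _ ≤ (2 * μ + 1) * k0 * (Ω * W) / (Ω * W) ^ ((2 * μ + 1 - 1) / (2 * μ + 1)) := by gcongr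
      _ = (2 * μ + 1) * k0 * ((Ω * W) / (Ω * W) ^ ((2 * μ + 1 - 1) / (2 * μ + 1))) := by ring
      _ = _ := by rw [self_div_rpow _ _ hX (by positivity)]; ring
  refine lt_of_le_of_lt hM ?_
  apply mul_lt_mul_of_pos_left _ (by positivity)
  have hJ0 : 0 < J := lt_of_lt_of_le (by positivity) hJl
  have hVp : 0 < 2 * (Real.pi ^ (j + 1) / ((j + 1).factorial : ℝ)) * J := by positivity
  have hnN : 1 / (2 * μ + 1) = ((2 * j + 3 : ℕ) : ℝ)⁻¹ := by rw [hμj, one_div]; congr 1; push_cast; ring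
  rw [hnN]
  apply lt_of_pow_lt_pow_left₀ (2 * j + 3) (by positivity)
  rw [mul_pow, Real.rpow_inv_natCast_pow hX.le (by omega), Real.rpow_inv_natCast_pow hVp.le (by omega)]
  have hkp : k0 ^ (2 * j + 3) = (3/8) ^ (j + 1) * k0 := by
    rw [← hk0s]; ring
  rw [hkp, hω]
  have hfac : ((j + 2).factorial : ℝ) = (μ + 1) * ((j + 1).factorial : ℝ) := by
    rw [Nat.factorial_succ (j + 1), hμj]; push_cast; ring
  rw [hfac]
  have hf : (0:ℝ) < ((j + 1).factorial : ℝ) := by exact_mod_cast Nat.factorial_pos _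
  have hkW : k0 * W * (2 * μ + 5) < 3/2 * (μ + 1) := by
    have hcμ : μ * c ^ 2 = 2 * μ - 1 := by rw [hc2]; linarith
    have b1 : (2 * μ + 1) * W * (μ + 5/6) ≤ (μ + 1) * (Real.sqrt 3 * (2 * μ - 1) * L ^ j) := by
      have := mul_le_mul_of_nonneg_right hWu (by positivity : 0 ≤ μ + 5/6)
      refine this.trans (le_of_eq ?_)
      rw [← hcμ]; field_simp
    have b2 := mul_le_mul_of_nonneg_left b1 (by positivity : 0 ≤ k0 * (2 * μ + 5))
    have b3 : k0 * (2 * μ + 5) * ((μ + 1) * (Real.sqrt 3 * (2 * μ - 1) * L ^ j))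
      = 3/4 * (μ + 1) * (Real.sqrt 2 * L ^ j * ((2 * μ - 1) * (2 * μ + 5))) := by
      rw [hk0d]
      linear_combination (Real.sqrt 2 / 4 * (2 * μ + 5) * (μ + 1) * (2 * μ - 1) * L ^ j) * hs2
    rw [b3] at b2
    have b4 := mul_lt_mul_of_pos_left hfin (by positivity : 0 < 3/4 * (μ + 1))
    have b5 : (k0 * W * (2 * μ + 5)) * ((2 * μ + 1) * (μ + 5/6)) < (3/2 * (μ + 1)) * ((2 * μ + 1) * (μ + 5/6)) := by
      linarith
    exact lt_of_mul_lt_mul_right b5 (by positivity)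
  have hP : 0 < Real.pi ^ (j + 1) / ((j + 1).factorial : ℝ) := by positivity
  push_cast at hJl
  rw [← hμj] at hJl
  calc _ = 2 * (Real.pi ^ (j + 1) / ((j + 1).factorial : ℝ)) * ((3/4) ^ (j + 1) * (k0 * W / (μ + 1))) := by
        have : (3/4:ℝ) ^ (j + 1) = (3/8) ^ (j + 1) * 2 ^ (j + 1) := by rw [← mul_pow]; norm_num
        rw [this]
        field_simp
        ring
    _ < 2 * (Real.pi ^ (j + 1) / ((j + 1).factorial : ℝ)) * ((3/4) ^ (j + 1) * (3/4 * (2 / (2 * μ + 5)))) := by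
        apply mul_lt_mul_of_pos_left _ (by positivity)
        apply mul_lt_mul_of_pos_left _ (by positivity)
        rw [← mul_div_assoc, div_lt_div_iff₀ (by positivity) (by positivity)]
        linarith
    _ = 2 * (Real.pi ^ (j + 1) / ((j + 1).factorial : ℝ)) * ((3/4) ^ (j + 1 + 1) * (2 / (2 * μ + 5))) := by ring
    _ ≤ _ := mul_le_mul_of_nonneg_left hJl (by positivity)

theorem M_lt_lambdaPlane_odd (n : ℕ) (hn : Odd n) (h5 : 5 ≤ n) (h2700 : n ≤ 2700) :
    lawsonCompetitorEnergy ((n - 1) / 2 - 1) ((n - 1) / 2) < lambdaPlane n := by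
  obtain ⟨m, rfl⟩ := hn
  obtain ⟨j, rfl⟩ : ∃ j, m = j + 1 := ⟨m - 1, by omega⟩
  have e1 : (2 * (j + 1) + 1 - 1) / 2 = j + 1 := by omega
  rw [e1, Nat.add_sub_cancel]
  exact main_ineq j (by omega)
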